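/- For every a > 0 there exists h > 0 such that every twice differentiable solution u : [0, ∞) → ℝ of u(x) − x·u′(x) = u″(x)/(1 + u′(x)²) with u′(0) = 0 and u(0) ≥ h satisfies lim_{x→∞} u′(x) > a; moreover then lim_{x→∞} u(x)/x > a and u(x) > a·x for all x ≥ 0. -/

import Mathlib

open Filter

/-- Gronwall-type bound: if `w' = -x q w` with `q ≤ C` on `[0, T]`, then `w² exp (C x²)` does not
decrease there. -/
theorem sq_le_sq_mul_exp_of_hasDerivAt {w q : ℝ → ℝ} {C T : ℝ}
    (hw : ∀ x, 0 ≤ x → HasDerivAt w (-(x * (w x * q x))) x)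
    (hq : ∀ x ∈ Set.Icc 0 T, q x ≤ C) {x : ℝ} (hx : x ∈ Set.Icc 0 T) :
    w 0 ^ 2 ≤ w x ^ 2 * Real.exp (C * x ^ 2) := by
  have hd : ∀ y, 0 ≤ y → HasDerivAt (fun y => w y ^ 2 * Real.exp (C * y ^ 2))
      (2 * y * (C - q y) * (w y ^ 2 * Real.exp (C * y ^ 2))) y := by
    intro y hy
    have h1 := (hw y hy).pow 2
    have h2 := (((hasDerivAt_id y).pow 2).const_mul C).exp
    refine (h1.mul h2).congr_deriv ?_
    simp only [Pi.pow_apply, id]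
    push_cast
    ring
  have hm : MonotoneOn (fun y => w y ^ 2 * Real.exp (C * y ^ 2)) (Set.Icc 0 T) := by
    refine monotoneOn_of_hasDerivWithinAt_nonneg (convex_Icc 0 T)
      (fun y hy => (hd y hy.1).continuousAt.continuousWithinAt)
      (fun y hy => (hd y (interior_subset hy).1).hasDerivWithinAt) ?_
    intro y hy
    have hy' := interior_subset hy
    have := sub_nonneg.2 (hq y hy')
    have := hy'.1
    positivity
  have := hm (Set.left_mem_Icc.2 (hx.1.trans hx.2)) hx hx.1
  simpa using this

/-- A solution of `w' = -x q w` on `[0, ∞)` with `q` continuous and `w 0 > 0` stays positive. -/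
theorem pos_of_hasDerivAt_neg_mul {w q : ℝ → ℝ}
    (hw : ∀ x, 0 ≤ x → HasDerivAt w (-(x * (w x * q x))) x)
    (hq : ContinuousOn q (Set.Ici 0)) (h0 : 0 < w 0) {x : ℝ} (hx : 0 ≤ x) : 0 < w x := by
  by_contra! hneg
  have hc : ContinuousOn w (Set.Icc 0 x) :=
    fun y hy => (hw y hy.1).continuousAt.continuousWithinAt
  obtain ⟨y, hy, hy0⟩ := intermediate_value_Icc' hx hc ⟨hneg, h0.le⟩
  obtain ⟨C, hC⟩ := isCompact_Icc.bddAbove_image (hq.mono (t := Set.Icc 0 x) fun z hz => hz.1)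
  have := sq_le_sq_mul_exp_of_hasDerivAt hw (fun z hz => hC (Set.mem_image_of_mem q hz)) hy
  rw [hy0] at this
  nlinarith [pow_pos h0 2]

/-- For every `a > 0` there is a height `h` such that every
solution of the self-expander ODE with `u'(0) = 0` and `u(0) ≥ h` has
asymptotic slope `lim_{x→∞} u'(x) > a`; then moreover
`lim_{x→∞} u(x)/x > a` and `u(x) > a·x` for all `x ≥ 0`. -/
theorem self_expander_big_slope (a : ℝ) (ha : 0 < a) :
    ∃ h : ℝ, 0 < h ∧
      ∀ u : ℝ → ℝ,
        (∀ x : ℝ, 0 ≤ x → DifferentiableAt ℝ u x) →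
        (∀ x : ℝ, 0 ≤ x → DifferentiableAt ℝ (deriv u) x) →
        (∀ x : ℝ, 0 ≤ x →
          u x - x * deriv u x = deriv (deriv u) x / (1 + (deriv u x) ^ 2)) →
        deriv u 0 = 0 → h ≤ u 0 →
        (∃ L : ℝ, Tendsto (deriv u) atTop (nhds L) ∧ a < L) ∧
        (∃ M : ℝ, Tendsto (fun x => u x / x) atTop (nhds M) ∧ a < M) ∧
        (∀ x : ℝ, 0 ≤ x → a * x < u x) := by
  refine ⟨(a + 1) * Real.exp (1 + a ^ 2), by positivity, ?_⟩
  intro u hu hp hode hp0 hh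
  set p := deriv u with hpdef
  have hu0 : 0 < u 0 := lt_of_lt_of_le (by positivity) hh
  have hp2 : ∀ x, 0 ≤ x → deriv p x = (u x - x * p x) * (1 + p x ^ 2) := by
    intro x hx
    rw [hode x hx]
    field_simp
  set w : ℝ → ℝ := fun x => u x - x * p x with hwdef
  have hw0 : w 0 = u 0 := by simp [hwdef]
  have hwd : ∀ x, 0 ≤ x → HasDerivAt w (-(x * (w x * (1 + p x ^ 2)))) x := by
    intro x hx
    have h1 := (hu x hx).hasDerivAt.sub ((hasDerivAt_id x).mul (hp x hx).hasDerivAt)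
    rw [hp2 x hx] at h1
    refine h1.congr_deriv ?_
    simp only [hwdef, id]
    ring
  have hpc : ContinuousOn p (Set.Ici 0) :=
    fun x hx => (hp x hx).continuousAt.continuousWithinAt
  have hwpos : ∀ x, 0 ≤ x → 0 < w x := fun x hx =>
    pos_of_hasDerivAt_neg_mul hwd (by fun_prop) (hw0 ▸ hu0) hx
  have hwanti : AntitoneOn w (Set.Ici 0) := by
    refine antitoneOn_of_hasDerivWithinAt_nonpos (convex_Ici 0)
      (fun y hy => (hwd y hy).continuousAt.continuousWithinAt)
      (fun y hy => (hwd y (interior_subset hy)).hasDerivWithinAt) ?_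
    intro y hy
    have hy' : 0 ≤ y := interior_subset hy
    have := hwpos y hy'
    rw [neg_nonpos]
    positivity
  have hpmono : MonotoneOn p (Set.Ici 0) := by
    refine monotoneOn_of_hasDerivWithinAt_nonneg (convex_Ici 0) hpc
      (fun y hy => (hp y (interior_subset hy)).hasDerivAt.hasDerivWithinAt) ?_
    intro y hy
    have hy' : 0 ≤ y := interior_subset hy
    have : 0 < u y - y * p y := hwpos y hy'
    rw [hp2 y hy']
    positivity
  have hpnonneg : ∀ x, 0 ≤ x → 0 ≤ p x := fun x hx =>
    hp0 ▸ hpmono Set.self_mem_Ici hx hx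
  have humono : MonotoneOn u (Set.Ici 0) :=
    monotoneOn_of_hasDerivWithinAt_nonneg (convex_Ici 0)
      (fun y hy => (hu y hy).continuousAt.continuousWithinAt)
      (fun y hy => (hu y (interior_subset hy)).hasDerivAt.hasDerivWithinAt)
      (fun y hy => hpnonneg y (interior_subset hy))
  have hha : a + 1 ≤ u 0 :=
    (le_mul_of_one_le_right (by positivity) (Real.one_le_exp (by positivity))).trans hh
  have hp1 : a < p 1 := by
    by_contra! hle
    have hpa : ∀ x ∈ Set.Icc (0 : ℝ) 1, 1 + p x ^ 2 ≤ 1 + a ^ 2 := by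
      intro x hx
      have h1 := hpmono hx.1 (Set.mem_Ici.2 zero_le_one) hx.2
      have := pow_le_pow_left₀ (hpnonneg x hx.1) (h1.trans hle) 2
      linarith
    have hwl : ∀ x ∈ Set.Icc (0 : ℝ) 1, a + 1 ≤ w x := by
      intro x hx
      have h1 := sq_le_sq_mul_exp_of_hasDerivAt hwd hpa hx
      have h2 : Real.exp ((1 + a ^ 2) * x ^ 2) ≤ Real.exp (1 + a ^ 2) ^ 2 := by
        rw [← Real.exp_nat_mul, Real.exp_le_exp]
        push_cast
        nlinarith [hx.1, hx.2, sq_nonneg a, pow_le_one₀ (n := 2) hx.1 hx.2]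
      have h3 : w 0 ^ 2 ≤ (w x * Real.exp (1 + a ^ 2)) ^ 2 := by
        rw [mul_pow]
        exact h1.trans (by gcongr)
      have hwx := hwpos x hx.1
      have h4 := (pow_le_pow_iff_left₀ (hw0 ▸ hu0.le) (by positivity) two_ne_zero).1 h3
      rw [hw0] at h4
      exact le_of_mul_le_mul_right (hh.trans h4) (Real.exp_pos _)
    have h5 := (convex_Icc (0 : ℝ) 1).mul_sub_le_image_sub_of_le_deriv
      (hpc.mono Set.Icc_subset_Ici_self)
      (fun x hx => (hp x (interior_subset hx).1).differentiableWithinAt)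
      (C := a + 1) (fun x hx => by
        have hx' := interior_subset hx
        have h6 : a + 1 ≤ u x - x * p x := hwl x hx'
        rw [hp2 x hx'.1]
        nlinarith [sq_nonneg (p x)])
      0 (by simp) 1 (by simp) zero_le_one
    rw [hp0] at h5
    linarith
  have hquot : AntitoneOn (fun x => u x / x) (Set.Ici 1) := by
    have hd : ∀ x, (1 : ℝ) ≤ x → HasDerivAt (fun x => u x / x) (-(w x / x ^ 2)) x := by
      intro x hx
      have hx0 : x ≠ 0 := by positivity
      refine ((hu x (by linarith)).hasDerivAt.div (hasDerivAt_id x) hx0).congr_deriv ?_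
      simp only [hwdef, id]
      ring
    refine antitoneOn_of_hasDerivWithinAt_nonpos (convex_Ici 1)
      (fun y hy => (hd y hy).continuousAt.continuousWithinAt)
      (fun y hy => (hd y (interior_subset hy)).hasDerivWithinAt) ?_
    intro y hy
    have hy' : (1 : ℝ) ≤ y := interior_subset hy
    have := hwpos y (by linarith)
    rw [neg_nonpos]
    positivity
  have hpbdd : ∀ x, 1 ≤ x → p x ≤ u 1 := by
    intro x hx
    have h1 : u x / x ≤ u 1 / 1 := hquot Set.self_mem_Ici hx hx
    have h2 : 0 < u x - x * p x := hwpos x (by linarith)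
    rw [div_one] at h1
    refine le_trans ?_ h1
    rw [le_div_iff₀ (by linarith)]
    linarith
  obtain ⟨L, hL⟩ : ∃ L, Tendsto p atTop (nhds L) := by
    have hm : Monotone fun x => p (max x 1) := fun x y hxy =>
      hpmono (Set.mem_Ici.2 (by positivity)) (Set.mem_Ici.2 (by positivity))
        (max_le_max_right 1 hxy)
    have hb : BddAbove (Set.range fun x => p (max x 1)) :=
      ⟨u 1, by rintro _ ⟨x, rfl⟩; exact hpbdd _ (le_max_right _ _)⟩
    refine ⟨_, (tendsto_atTop_ciSup hm hb).congr' ?_⟩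
    filter_upwards [eventually_ge_atTop 1] with x hx
    rw [max_eq_left hx]
  have haL : a < L := hp1.trans_le <| ge_of_tendsto hL <| by
    filter_upwards [eventually_ge_atTop 1] with x hx
    exact hpmono (Set.mem_Ici.2 zero_le_one) (Set.mem_Ici.2 (by linarith)) hx
  refine ⟨⟨L, hL, haL⟩, ⟨L, ?_, haL⟩, ?_⟩
  · have hwx : Tendsto (fun x => w x / x) atTop (nhds 0) := by
      refine tendsto_of_tendsto_of_tendsto_of_le_of_le' tendsto_const_nhds
        (tendsto_const_nhds.div_atTop tendsto_id : Tendsto (fun x => u 0 / x) atTop (nhds 0)) ?_ ?_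
      · filter_upwards [eventually_ge_atTop 0] with x hx
        exact div_nonneg (hwpos x hx).le hx
      · filter_upwards [eventually_ge_atTop 0] with x hx
        have := hwanti Set.self_mem_Ici hx hx
        rw [hw0] at this
        gcongr
    have hsum := hL.add hwx
    rw [add_zero] at hsum
    refine hsum.congr' ?_
    filter_upwards [eventually_gt_atTop 0] with x hx
    simp only [hwdef]
    field_simp
    ring
  · intro x hx
    rcases le_total x 1 with h1 | h1
    · have := humono Set.self_mem_Ici hx hx
      nlinarith
    · have h2 : 0 < u x - x * p x := hwpos x hx
      have h3 := hpmono (Set.mem_Ici.2 zero_le_one) hx h1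
      nlinarith
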